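/- arXiv:2004.00239 — 4 statements merged into one kernel-verified Lean document; each statement's English description precedes it below -/
import Mathlib

section
/- Let n ≥ 1, let k > 0, and let g_ST, g_SD : ℝ → Mₙ(ℂ) be differentiable matrix-valued functions all of whose values are invertible. Define the configuration error g_TD(t) = g_ST(t)⁻¹ · g_SD(t) and assume that ‖g_TD(t) − 1‖ < 1 for all t ∈ ℝ (in a submultiplicative matrix norm). Define the state error ξ_TD(t) = log(g_TD(t)) = ∑_{m=1}^∞ (−1)^{m+1} (g_TD(t) − 1)^m / m. Suppose the closed-loop control law holds: for all t, g_ST′(t) = g_ST(t) · ( k · ξ_TD(t) + g_TD(t) · (g_SD(t)⁻¹ · g_SD′(t)) · g_TD(t)⁻¹ ). Then for all t ∈ ℝ, ξ_TD(t) = e^{−kt} · ξ_TD(0); in particular the state error converges to 0 exponentially with rate k as t → ∞. -/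
open scoped Matrix
open NormedSpace

attribute [local instance] Matrix.linftyOpNormedRing Matrix.linftyOpNormedAlgebra

/-- The power-series matrix logarithm `∑_{m=1}^∞ (−1)^{m+1} (g − 1)^m / m`. -/
noncomputable def matLog {n : ℕ} (g : Matrix (Fin n) (Fin n) ℂ) : Matrix (Fin n) (Fin n) ℂ :=
  ∑' m : ℕ, (((-1 : ℂ) ^ m / ((m : ℂ) + 1)) • (g - 1) ^ (m + 1))

section Generic
variable {A : Type*} [NormedRing A] [NormOneClass A] [NormedAlgebra ℝ A] [CompleteSpace A]

noncomputable def genLog (x : A) : A :=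
  ∑' m : ℕ, (((-1 : ℝ) ^ m / ((m : ℝ) + 1)) • x ^ (m + 1))

theorem genLog_coef (m : ℕ) : ‖((-1 : ℝ) ^ m / ((m : ℝ) + 1))‖ = 1 / ((m : ℝ) + 1) := by
  have : ‖((m : ℝ) + 1)‖ = (m : ℝ) + 1 := by
    rw [Real.norm_eq_abs, abs_of_nonneg (by positivity)]
  rw [norm_div, this]; simp

theorem genLog_term (x : A) (r : ℝ) (hx : ‖x‖ ≤ r) (m : ℕ) :
    ‖(((-1 : ℝ) ^ m / ((m : ℝ) + 1)) • x ^ (m + 1))‖ ≤ r ^ (m + 1) := by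
  rw [norm_smul, genLog_coef]
  have h1 : ‖x ^ (m + 1)‖ ≤ r ^ (m + 1) :=
    (norm_pow_le x (m + 1)).trans (pow_le_pow_left₀ (norm_nonneg _) hx _)
  have h2 : 1 / ((m : ℝ) + 1) ≤ 1 := by
    rw [div_le_one (by positivity)]; linarith [(Nat.cast_nonneg m : (0 : ℝ) ≤ m)]
  calc _ ≤ 1 * ‖x ^ (m + 1)‖ := mul_le_mul_of_nonneg_right h2 (norm_nonneg _)
    _ ≤ _ := by rw [one_mul]; exact h1

theorem summable_geo (r : ℝ) (h0 : 0 ≤ r) (hr : r < 1) : Summable (fun m : ℕ => r ^ (m + 1)) :=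
  (summable_nat_add_iff 1).2 (summable_geometric_of_lt_one h0 hr)

theorem genLog_summable (x : A) (hx : ‖x‖ < 1) :
    Summable (fun m : ℕ => (((-1 : ℝ) ^ m / ((m : ℝ) + 1)) • x ^ (m + 1))) :=
  Summable.of_norm_bounded (summable_geo ‖x‖ (norm_nonneg _) hx)
    (genLog_term x ‖x‖ le_rfl)

theorem genLog_bound (x : A) (r : ℝ) (hx : ‖x‖ ≤ r) (hr : r < 1) :
    ‖genLog x‖ ≤ ∑' m : ℕ, r ^ (m + 1) :=
  tsum_of_norm_bounded (summable_geo r ((norm_nonneg _).trans hx) hr).hasSum (genLog_term x r hx)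

theorem genLog_commute (x : A) (hx : ‖x‖ < 1) : Commute x (genLog x) := by
  unfold Commute SemiconjBy genLog
  rw [← (genLog_summable x hx).tsum_mul_left, ← (genLog_summable x hx).tsum_mul_right]
  congr 1; ext m
  rw [mul_smul_comm, smul_mul_assoc, ← pow_succ, ← pow_succ']

theorem pow_deriv_comm (X : ℝ → A) (D : A) (t : ℝ) (h : HasDerivAt X D t)
    (hc : Commute (X t) D) (m : ℕ) :
    HasDerivAt (fun s => X s ^ (m + 1)) (((m : ℝ) + 1) • (X t ^ m * D)) t := by
  induction m with
  | zero => simpa using h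
  | succ m ih =>
    have h2 := ih.mul h
    have e : (fun s => X s ^ (m + 1 + 1)) = (fun s => X s ^ (m + 1)) * X := by
      ext s; simp [pow_succ]
    rw [e]
    convert h2 using 1
    rw [smul_mul_assoc, mul_assoc, ← hc.eq, ← mul_assoc, ← pow_succ]
    push_cast
    rw [add_smul _ (1 : ℝ), one_smul]

theorem genLog_deriv (k : ℝ) (X X' : ℝ → A) (hX : ∀ t, HasDerivAt X (X' t) t)
    (hn : ∀ t, ‖X t‖ < 1) (hX' : ∀ t, X' t = (1 + X t) * (-(k • genLog (X t)))) (t : ℝ) :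
    HasDerivAt (fun s => genLog (X s)) (-(k • genLog (X t))) t := by
  have hc : ∀ s, Commute (X s) (X' s) := fun s => by
    rw [hX' s]
    exact ((Commute.one_right _).add_right (Commute.refl _)).mul_right
      (((genLog_commute (X s) (hn s)).smul_right k).neg_right)
  obtain ⟨r, hr1, hr2⟩ := exists_between (hn t)
  have hr0 : 0 ≤ r := (norm_nonneg _).trans hr1.le
  have hev : ∀ᶠ s in nhds t, ‖X s‖ < r :=
    (hX t).continuousAt.norm.eventually_lt continuousAt_const hr1
  obtain ⟨ε, hε, hball⟩ := Metric.eventually_nhds_iff_ball.1 hev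
  set C : ℝ := 2 * (|k| * ∑' m : ℕ, r ^ (m + 1)) with hC
  have hCb : ∀ s, ‖X s‖ < r → ‖X' s‖ ≤ C := fun s hs => by
    rw [hX' s]
    refine (norm_mul_le _ _).trans ?_
    have h1 : ‖1 + X s‖ ≤ 2 := by
      refine (norm_add_le _ _).trans ?_
      rw [norm_one]; linarith
    have h2 : ‖-(k • genLog (X s))‖ ≤ |k| * ∑' m : ℕ, r ^ (m + 1) := by
      rw [norm_neg, norm_smul, Real.norm_eq_abs]
      exact mul_le_mul_of_nonneg_left (genLog_bound _ r hs.le hr2) (abs_nonneg _)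
    exact mul_le_mul h1 h2 (norm_nonneg _) (by norm_num)
  have hcoef : ∀ m : ℕ, ((-1 : ℝ) ^ m / ((m : ℝ) + 1)) * ((m : ℝ) + 1) = (-1) ^ m := fun m =>
    div_mul_cancel₀ _ (by exact_mod_cast Nat.succ_ne_zero m)
  have key := hasDerivAt_tsum_of_isPreconnected (𝕜 := ℝ)
    (g := fun (m : ℕ) s => (((-1 : ℝ) ^ m / ((m : ℝ) + 1)) • X s ^ (m + 1)))
    (g' := fun (m : ℕ) s => ((-1 : ℝ) ^ m) • (X s ^ m * X' s))
    (u := fun m => r ^ m * C) (t := Metric.ball t ε) (y₀ := t) (y := t)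
    ((summable_geometric_of_lt_one hr0 hr2).mul_right C) Metric.isOpen_ball
    (convex_ball t ε).isPreconnected
    (fun m y _ => by
      have := (pow_deriv_comm X (X' y) y (hX y) (hc y) m).const_smul
        ((-1 : ℝ) ^ m / ((m : ℝ) + 1))
      rw [smul_smul, hcoef] at this
      exact this)
    (fun m y hy => by
      have hy' := hball y hy
      rw [norm_smul, norm_pow, norm_neg, norm_one, one_pow, one_mul]
      refine (norm_mul_le _ _).trans ?_
      exact mul_le_mul ((norm_pow_le _ _).trans (pow_le_pow_left₀ (norm_nonneg _) hy'.le _))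
        (hCb y hy') (norm_nonneg _) (by positivity))
    (Metric.mem_ball_self hε) (genLog_summable _ (hn t)) (Metric.mem_ball_self hε)
  have hneg : ‖-X t‖ < 1 := by rw [norm_neg]; exact hn t
  have e : ∑' m : ℕ, ((-1 : ℝ) ^ m) • (X t ^ m * X' t) = -(k • genLog (X t)) := by
    have e1 : ∀ m : ℕ, ((-1 : ℝ) ^ m) • (X t ^ m * X' t) = (-X t) ^ m * X' t := fun m => by
      rw [← smul_mul_assoc, neg_pow (X t)]
      rcases Nat.even_or_odd m with h | h <;> simp [h.neg_one_pow]
    simp_rw [e1]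
    rw [(summable_geometric_of_norm_lt_one hneg).tsum_mul_right, hX' t, ← mul_assoc]
    have := geom_series_mul_neg (-X t) hneg
    rw [sub_neg_eq_add] at this
    rw [this, one_mul]
  rw [e] at key
  exact key

theorem exp_of_deriv (k : ℝ) (f : ℝ → A) (hf : ∀ t, HasDerivAt f (-(k • f t)) t) (t : ℝ) :
    f t = Real.exp (-k * t) • f 0 := by
  have h : ∀ s, HasDerivAt (fun s => Real.exp (k * s) • f s) 0 s := fun s => by
    have h1 : HasDerivAt (fun s : ℝ => Real.exp (k * s)) (Real.exp (k * s) * k) s := by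
      simpa using ((hasDerivAt_id s).const_mul k).exp
    refine HasDerivAt.congr_deriv (h1.smul (hf s)) ?_
    rw [smul_neg, smul_smul]; simp
  have := is_const_of_deriv_eq_zero (fun s => (h s).differentiableAt) (fun s => (h s).deriv) t 0
  simp only [mul_zero, Real.exp_zero, one_smul] at this
  rw [← this, smul_smul, ← Real.exp_add]; simp

theorem gen_main (k : ℝ) (S D S' D' G : ℝ → A)
    (hS : ∀ t, HasDerivAt S (S' t) t) (hD : ∀ t, HasDerivAt D (D' t) t)
    (hSu : ∀ t, IsUnit (S t)) (hDu : ∀ t, IsUnit (D t))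
    (hG : ∀ t, G t = Ring.inverse (S t) * D t) (hn : ∀ t, ‖G t - 1‖ < 1)
    (hcl : ∀ t, S' t = S t * (k • genLog (G t - 1) +
      G t * (Ring.inverse (D t) * D' t) * Ring.inverse (G t))) (t : ℝ) :
    genLog (G t - 1) = Real.exp (-k * t) • genLog (G 0 - 1) := by
  refine exp_of_deriv k (fun s => genLog (G s - 1)) (fun s => ?_) t
  refine genLog_deriv k (fun s => G s - 1) (fun s => (1 + (G s - 1)) * (-(k • genLog (G s - 1))))
    (fun s => ?_) hn (fun _ => rfl) s
  refine HasDerivAt.sub_const 1 ?_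
  obtain ⟨u, hu⟩ := hSu s
  have h1 : HasDerivAt (fun s => Ring.inverse (S s))
      (-(Ring.inverse (S s) * S' s * Ring.inverse (S s))) s := by
    have h := hasFDerivAt_ringInverse (𝕜 := ℝ) u
    rw [hu] at h
    have h' := h.comp_hasDerivAt s (hS s)
    refine HasDerivAt.congr_deriv h' ?_
    simp [← hu]
  have h2 := h1.mul (hD s)
  have eG : G = (fun s => Ring.inverse (S s)) * D := by ext s; exact hG s
  rw [← eG] at h2
  refine HasDerivAt.congr_deriv h2 ?_
  symm
  have hGu : IsUnit (G s) := by rw [hG s]; exact (hSu s).ringInverse.mul (hDu s)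
  have c := genLog_commute (G s - 1) (hn s)
  have c2 : Commute (G s) (genLog (G s - 1)) := by
    have := c.add_left (Commute.one_left (genLog (G s - 1)))
    simpa using this
  have e1 : Ring.inverse (S s) * S' s = k • genLog (G s - 1) +
      G s * (Ring.inverse (D s) * D' s) * Ring.inverse (G s) := by
    rw [hcl s, ← mul_assoc, Ring.inverse_mul_cancel _ (hSu s), one_mul]
  have e2 : Ring.inverse (S s) * D' s = G s * (Ring.inverse (D s) * D' s) := by
    rw [hG s, mul_assoc, ← mul_assoc (D s), Ring.mul_inverse_cancel _ (hDu s), one_mul]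
  have e3 : -(Ring.inverse (S s) * S' s * Ring.inverse (S s)) * D s
      = - (Ring.inverse (S s) * S' s * G s) := by rw [hG s, neg_mul, mul_assoc]
  rw [e3, e2, e1, add_sub_cancel, add_mul, mul_assoc _ (Ring.inverse (G s)), Ring.inverse_mul_cancel _ hGu,
    mul_one, mul_neg, mul_smul_comm, c2.eq, smul_mul_assoc]
  abel
end Generic

/-- First order control on matrix Lie groups: local exponential convergence of the
state error `ξ_TD(t) = log (g_TD t)` under the closed-loop control law. -/
theorem stmt_0 (n : ℕ) (hn : 1 ≤ n) (k : ℝ) (hk : 0 < k)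
    (g_ST g_SD dg_ST dg_SD : ℝ → Matrix (Fin n) (Fin n) ℂ)
    (hST : ∀ t : ℝ, HasDerivAt g_ST (dg_ST t) t)
    (hSD : ∀ t : ℝ, HasDerivAt g_SD (dg_SD t) t)
    (hSTu : ∀ t : ℝ, IsUnit (g_ST t))
    (hSDu : ∀ t : ℝ, IsUnit (g_SD t))
    (g_TD : ℝ → Matrix (Fin n) (Fin n) ℂ)
    (hTD : ∀ t : ℝ, g_TD t = (g_ST t)⁻¹ * g_SD t)
    (hnorm : ∀ t : ℝ, ‖g_TD t - 1‖ < 1)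
    (ξ : ℝ → Matrix (Fin n) (Fin n) ℂ)
    (hξ : ∀ t : ℝ, ξ t = matLog (g_TD t))
    (hclosed : ∀ t : ℝ, dg_ST t =
      g_ST t * (k • ξ t + g_TD t * ((g_SD t)⁻¹ * dg_SD t) * (g_TD t)⁻¹)) :
    ∀ t : ℝ, ξ t = Real.exp (-k * t) • ξ 0 := by
  haveI : Nonempty (Fin n) := ⟨⟨0, hn⟩⟩
  haveI : NormOneClass (Matrix (Fin n) (Fin n) ℂ) := Matrix.linfty_opNormOneClass
  intro t
  have e : ∀ s, ξ s = genLog (g_TD s - 1) := fun s => by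
    rw [hξ s]
    unfold matLog genLog
    congr 1; ext1 m
    rw [← Complex.coe_smul]
    push_cast
    rfl
  rw [e t, e 0]
  refine gen_main k g_ST g_SD dg_ST dg_SD g_TD hST hSD hSTu hSDu (fun s => ?_) hnorm
    (fun s => ?_) t
  · rw [← Matrix.nonsing_inv_eq_ringInverse]; exact hTD s
  · rw [← Matrix.nonsing_inv_eq_ringInverse, ← Matrix.nonsing_inv_eq_ringInverse, ← e s]
    exact hclosed s
end

section
/- Let n ≥ 1, let k > 0, and let g_ST, g_SD : ℝ → Mₙ(ℂ) be differentiable matrix-valued functions all of whose values are invertible. Define g_TD(t) = g_ST(t)⁻¹ · g_SD(t), assume ‖g_TD(t) − 1‖ < 1 for all t (in a submultiplicative matrix norm), set ξ_TD(t) = ∑_{m=1}^∞ (−1)^{m+1} (g_TD(t) − 1)^m / m, and suppose that for all t, g_ST′(t) = g_ST(t) · ( k · ξ_TD(t) + g_TD(t) · (g_SD(t)⁻¹ · g_SD′(t)) · g_TD(t)⁻¹ ). Then for all t ≥ 0, ‖g_TD(t) − 1‖ ≤ ‖ξ_TD(0)‖ · e^{‖ξ_TD(0)‖} · e^{−kt};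 in particular the configuration error g_TD(t) converges exponentially to the identity matrix. -/
open scoped Matrix
open NormedSpace

attribute [local instance] Matrix.linftyOpNormedRing Matrix.linftyOpNormedAlgebra

section Helpers
variable {A : Type*} [NormedRing A] [NormedAlgebra ℝ A] [CompleteSpace A] [NormOneClass A]

/-- The power series of `log (1 + x)`. -/
noncomputable def logOneAdd (x : A) : A :=
  ∑' m : ℕ, (((-1 : ℝ) ^ m / ((m : ℝ) + 1)) • x ^ (m + 1))

theorem logOneAdd_commute {x y : A} (h : Commute x y) : Commute (logOneAdd x) y :=
  Commute.tsum_left _ fun _ => (h.pow_left _).smul_left _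

theorem logOneAdd_zero : logOneAdd (0 : A) = 0 := by
  simp [logOneAdd]

/-- Term of the derivative of the logarithm series. -/
noncomputable def logTerm (m : ℕ) (x : A) : A →L[ℝ] A :=
  ((-1 : ℝ) ^ m / ((m : ℝ) + 1)) •
    (∑ i ∈ Finset.range (m + 1), (ContinuousLinearMap.mulLeftRight ℝ A (x ^ (m - i)) (x ^ i)))

theorem logTerm_apply (m : ℕ) (x h : A) : logTerm m x h = ((-1 : ℝ) ^ m / ((m : ℝ) + 1)) •
    ∑ i ∈ Finset.range (m + 1), x ^ (m - i) * h * x ^ i := by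
  simp [logTerm]

theorem logTerm_norm (m : ℕ) (x : A) (r : ℝ) (hx : ‖x‖ ≤ r) : ‖logTerm m x‖ ≤ r ^ m := by
  have hr : 0 ≤ r := (norm_nonneg _).trans hx
  refine ContinuousLinearMap.opNorm_le_bound _ (by positivity) fun h => ?_
  rw [logTerm_apply, norm_smul]
  have h1 : ‖((-1 : ℝ) ^ m / ((m : ℝ) + 1))‖ = 1 / ((m : ℝ) + 1) := by
    rw [norm_div, norm_pow, norm_neg, norm_one, one_pow, Real.norm_of_nonneg (by positivity)]
  have h2 : ‖∑ i ∈ Finset.range (m + 1), x ^ (m - i) * h * x ^ i‖ ≤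
      ∑ i ∈ Finset.range (m + 1), r ^ m * ‖h‖ := by
    refine norm_sum_le_of_le _ fun i hi => ?_
    have hi' : i ≤ m := Nat.lt_succ_iff.mp (Finset.mem_range.mp hi)
    calc ‖x ^ (m - i) * h * x ^ i‖ ≤ ‖x ^ (m - i)‖ * ‖h‖ * ‖x ^ i‖ :=
          (norm_mul_le _ _).trans (by gcongr; exact norm_mul_le _ _)
      _ ≤ r ^ (m - i) * ‖h‖ * r ^ i := by
          gcongr
          · exact (norm_pow_le _ _).trans (by gcongr)
          · exact (norm_pow_le _ _).trans (by gcongr)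
      _ = r ^ (m - i + i) * ‖h‖ := by rw [pow_add]; ring
      _ = r ^ m * ‖h‖ := by rw [Nat.sub_add_cancel hi']
  rw [h1]
  calc _ ≤ 1 / ((m : ℝ) + 1) * ∑ i ∈ Finset.range (m + 1), r ^ m * ‖h‖ := by gcongr
    _ = r ^ m * ‖h‖ := by
      rw [Finset.sum_const, Finset.card_range, nsmul_eq_mul]
      push_cast
      field_simp

theorem logOneAdd_hasFDerivAt {x : A} (hx : ‖x‖ < 1) :
    HasFDerivAt (logOneAdd : A → A) (∑' m, logTerm m x) x := by
  obtain ⟨r, hr, hr1⟩ := exists_between hx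
  have hr0 : 0 < r := (norm_nonneg _).trans_lt hr
  refine hasFDerivAt_tsum_of_isPreconnected (𝕜 := ℝ)
    (u := fun m => r ^ m) (s := Metric.ball (0 : A) r) (x₀ := 0)
    (summable_geometric_of_lt_one hr0.le hr1) Metric.isOpen_ball
    (convex_ball (0 : A) r).isPreconnected ?_ ?_ (Metric.mem_ball_self hr0) ?_ (by simpa using hr)
  · intro m y hy
    have := (hasFDerivAt_pow' (𝕜 := ℝ) (m + 1) (x := y)).const_smul ((-1 : ℝ) ^ m / ((m : ℝ) + 1))
    refine this.congr_fderiv ?_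
    ext h
    rw [logTerm_apply]
    simp [mul_assoc]
  · intro m y hy
    exact logTerm_norm m y r (by simpa using (Metric.mem_ball.mp hy).le)
  · simpa using summable_zero

theorem logOneAdd_hasDerivAt {f : ℝ → A} {f' : A} {t : ℝ} (hf : HasDerivAt f f' t)
    (hx : ‖f t‖ < 1) (hc : Commute (f t) f') :
    HasDerivAt (fun s => logOneAdd (f s)) ((∑' m : ℕ, (-(f t)) ^ m) * f') t := by
  have := (logOneAdd_hasFDerivAt hx).comp_hasDerivAt t hf
  refine this.congr_deriv ?_
  have hs : Summable fun m => logTerm m (f t) :=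
    Summable.of_norm_bounded (summable_geometric_of_lt_one (norm_nonneg _) hx)
      fun m => logTerm_norm m (f t) _ le_rfl
  have hs2 : Summable fun m : ℕ => (-(f t)) ^ m :=
    summable_geometric_of_norm_lt_one (by simpa using hx)
  rw [← hs2.tsum_mul_right]
  rw [← ContinuousLinearMap.apply_apply (𝕜 := ℝ) f' (∑' m, logTerm m (f t)),
    ContinuousLinearMap.map_tsum _ hs]
  refine tsum_congr fun m => ?_
  rw [ContinuousLinearMap.apply_apply, logTerm_apply]
  have : ∀ i ∈ Finset.range (m + 1), f t ^ (m - i) * f' * f t ^ i = f t ^ m * f' := by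
    intro i hi
    have hi' : i ≤ m := Nat.lt_succ_iff.mp (Finset.mem_range.mp hi)
    rw [mul_assoc, ← (hc.pow_left i).eq, ← mul_assoc, ← pow_add, Nat.sub_add_cancel hi']
  rw [Finset.sum_congr rfl this, Finset.sum_const, Finset.card_range, ← Nat.cast_smul_eq_nsmul ℝ,
    smul_smul, neg_pow (f t)]
  push_cast
  rw [div_mul_cancel₀ _ (by positivity)]
  rcases neg_one_pow_eq_or ℝ m with h | h <;> rcases Nat.even_or_odd m with h' | h' <;>
    simp [h'.neg_one_pow]

theorem exp_hasDerivAt_of_commute {G : ℝ → A} {G' : A} {t : ℝ} (hG : HasDerivAt G G' t)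
    (hc : ∀ s, Commute (G t) (G s)) :
    HasDerivAt (fun s => exp (G s)) (exp (G t) * G') t := by
  letI : NormedAlgebra ℚ A := NormedAlgebra.restrictScalars ℚ ℝ A
  have h0 : HasFDerivAt (exp : A → A) (1 : A →L[ℝ] A) (G t - G t) := by
    rw [sub_self]; exact hasFDerivAt_exp_zero
  have h1 := ((h0.comp_hasDerivAt t (hG.sub_const (G t))).const_mul (exp (G t)))
  refine (h1.congr_deriv (by simp)).congr_of_eventuallyEq (Filter.Eventually.of_forall fun s => ?_)
  have : Commute (G t) (G s - G t) := (hc s).sub_right (Commute.refl _)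
  have h2 := exp_add_of_commute this
  rw [add_sub_cancel] at h2
  simpa using h2

theorem exp_logOneAdd {X : A} (hX : ‖X‖ < 1) : exp (logOneAdd X) = 1 + X := by
  letI : NormedAlgebra ℚ A := NormedAlgebra.restrictScalars ℚ ℝ A
  have key : ∀ s ∈ Set.Icc (0 : ℝ) 1,
      HasDerivAt (fun s : ℝ => exp (-logOneAdd (s • X)) * (1 + s • X)) 0 s := by
    intro s hs
    have hn : ‖s • X‖ < 1 := by
      rw [norm_smul, Real.norm_of_nonneg hs.1]
      exact (mul_le_of_le_one_left (norm_nonneg _) hs.2).trans_lt hX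
    have hd : HasDerivAt (fun s : ℝ => s • X) X s := by
      simpa using (hasDerivAt_id s).smul_const X
    have hcX : Commute (s • X) X := (Commute.refl X).smul_left s
    have h1 := (logOneAdd_hasDerivAt hd hn hcX).neg
    have h2 := exp_hasDerivAt_of_commute h1 (fun u => by
      refine Commute.neg_left (Commute.neg_right ?_)
      refine logOneAdd_commute (Commute.symm (logOneAdd_commute ?_))
      exact ((Commute.refl X).smul_left u).smul_right s)
    have h3 := h2.mul (hd.const_add 1)
    refine h3.congr_deriv ?_
    have hg : (∑' m : ℕ, (-(s • X)) ^ m) * (1 + s • X) = 1 := by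
      have := geom_series_mul_neg (-(s • X)) (by simpa using hn)
      simpa using this
    have hc2 : X * (1 + s • X) = (1 + s • X) * X := by
      simp [mul_add, add_mul]
    simp only [mul_neg, neg_mul, mul_assoc, Pi.neg_apply]
    rw [hc2, ← mul_assoc (∑' m : ℕ, (-(s • X)) ^ m), hg]
    simp
  have hconst := constant_of_has_deriv_right_zero
    (f := fun s : ℝ => exp (-logOneAdd (s • X)) * (1 + s • X)) (a := 0) (b := 1)
    (fun s hs => (key s hs).continuousAt.continuousWithinAt)
    (fun s hs => (key s (Set.Ico_subset_Icc_self hs)).hasDerivWithinAt) 1 (by simp)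
  simp only [one_smul, zero_smul, logOneAdd_zero, neg_zero, exp_zero, add_zero, mul_one] at hconst
  have h5 : exp (logOneAdd X) * exp (-logOneAdd X) = 1 := by
    rw [← exp_add_of_commute (Commute.neg_right (Commute.refl _)), add_neg_cancel, exp_zero]
  calc exp (logOneAdd X) = exp (logOneAdd X) * (exp (-logOneAdd X) * (1 + X)) := by
        rw [hconst, mul_one]
    _ = 1 + X := by rw [← mul_assoc, h5, one_mul]

theorem norm_exp_sub_one_le_mul (X : A) : ‖exp X - 1‖ ≤ ‖X‖ * Real.exp ‖X‖ := by
  have h1 := (exp_series_hasSum_exp' (𝕂 := ℝ) X)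
  have h2 := (exp_series_hasSum_exp' (𝕂 := ℝ) ‖X‖)
  rw [← Real.exp_eq_exp_ℝ] at h2
  have h1' := (hasSum_nat_add_iff' 1).mpr h1
  have h2' := (hasSum_nat_add_iff' 1).mpr h2
  simp only [Finset.range_one, Finset.sum_singleton, Nat.factorial_zero, pow_zero, Nat.cast_one,
    inv_one, one_smul] at h1' h2'
  have h3 : ‖exp X - 1‖ ≤ Real.exp ‖X‖ - 1 := by
    rw [← h1'.tsum_eq]
    refine tsum_of_norm_bounded h2' fun i => ?_
    rw [norm_smul, smul_eq_mul, Real.norm_of_nonneg (by positivity)]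
    gcongr
    exact norm_pow_le _ _
  have h4 := Real.add_one_le_exp (-‖X‖)
  have h5 : Real.exp (-‖X‖) * Real.exp ‖X‖ = 1 := by rw [← Real.exp_add]; simp
  nlinarith [Real.exp_pos ‖X‖]

theorem error_bound (k : ℝ) (hk : 0 < k) (g : ℝ → A) (hn : ∀ t, ‖g t - 1‖ < 1)
    (hg : ∀ t, HasDerivAt g (-(k • (logOneAdd (g t - 1) * g t))) t) (t : ℝ) (ht : 0 ≤ t) :
    ‖g t - 1‖ ≤ ‖logOneAdd (g 0 - 1)‖ * Real.exp ‖logOneAdd (g 0 - 1)‖ * Real.exp (-k * t) := by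
  have hξ : ∀ s, HasDerivAt (fun s => logOneAdd (g s - 1)) (-(k • logOneAdd (g s - 1))) s := by
    intro s
    have hcl : Commute (g s - 1) (logOneAdd (g s - 1)) :=
      (logOneAdd_commute (Commute.refl _)).symm
    have hcg : Commute (g s - 1) (g s) := (Commute.refl _).sub_left (Commute.one_left _)
    have h1 := logOneAdd_hasDerivAt ((hg s).sub_const 1) (hn s)
      (((hcl.mul_right hcg).smul_right k).neg_right)
    refine h1.congr_deriv ?_
    have hgeo : (∑' m : ℕ, (-(g s - 1)) ^ m) * g s = 1 := by
      have := geom_series_mul_neg (-(g s - 1)) (by simpa only [norm_neg] using hn s)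
      simpa using this
    have hlg : Commute (logOneAdd (g s - 1)) (g s) := logOneAdd_commute hcg
    rw [hlg.eq, mul_neg, mul_smul_comm, ← mul_assoc, hgeo, one_mul]
  have hconst : ∀ s, HasDerivAt (fun s => Real.exp (k * s) • logOneAdd (g s - 1)) 0 s := by
    intro s
    have he : HasDerivAt (fun s => Real.exp (k * s)) (Real.exp (k * s) * k) s := by
      simpa using ((hasDerivAt_id s).const_mul k).exp
    refine (he.smul (hξ s)).congr_deriv ?_
    simp [smul_smul]
  have h0 : Real.exp (k * t) • logOneAdd (g t - 1) = logOneAdd (g 0 - 1) := by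
    have := is_const_of_deriv_eq_zero (fun s => (hconst s).differentiableAt)
      (fun s => (hconst s).deriv) t 0
    simpa using this
  have h1 : logOneAdd (g t - 1) = Real.exp (-k * t) • logOneAdd (g 0 - 1) := by
    rw [← h0, smul_smul, ← Real.exp_add]; simp
  have h2 : g t - 1 = exp (logOneAdd (g t - 1)) - 1 := by
    rw [exp_logOneAdd (hn t)]; abel
  rw [h2]
  refine (norm_exp_sub_one_le_mul _).trans ?_
  have h3 : ‖logOneAdd (g t - 1)‖ = Real.exp (-k * t) * ‖logOneAdd (g 0 - 1)‖ := by
    rw [h1, norm_smul, Real.norm_of_nonneg (Real.exp_pos _).le]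
  have h4 : ‖logOneAdd (g t - 1)‖ ≤ ‖logOneAdd (g 0 - 1)‖ := by
    rw [h3]
    exact mul_le_of_le_one_left (norm_nonneg _) (Real.exp_le_one_iff.mpr (by nlinarith))
  calc ‖logOneAdd (g t - 1)‖ * Real.exp ‖logOneAdd (g t - 1)‖
      ≤ (Real.exp (-k * t) * ‖logOneAdd (g 0 - 1)‖) * Real.exp ‖logOneAdd (g 0 - 1)‖ := by
        rw [← h3]; gcongr
    _ = _ := by ring

end Helpers

/-- First order control on matrix Lie groups: exponential convergence of the
configuration error `g_TD` to the identity under the closed-loop control law. -/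
theorem stmt_1 (n : ℕ) (hn : 1 ≤ n) (k : ℝ) (hk : 0 < k)
    (g_ST g_SD dg_ST dg_SD : ℝ → Matrix (Fin n) (Fin n) ℂ)
    (hST : ∀ t : ℝ, HasDerivAt g_ST (dg_ST t) t)
    (hSD : ∀ t : ℝ, HasDerivAt g_SD (dg_SD t) t)
    (hSTu : ∀ t : ℝ, IsUnit (g_ST t))
    (hSDu : ∀ t : ℝ, IsUnit (g_SD t))
    (g_TD : ℝ → Matrix (Fin n) (Fin n) ℂ)
    (hTD : ∀ t : ℝ, g_TD t = (g_ST t)⁻¹ * g_SD t)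
    (hnorm : ∀ t : ℝ, ‖g_TD t - 1‖ < 1)
    (ξ : ℝ → Matrix (Fin n) (Fin n) ℂ)
    (hξ : ∀ t : ℝ, ξ t = matLog (g_TD t))
    (hclosed : ∀ t : ℝ, dg_ST t =
      g_ST t * (k • ξ t + g_TD t * ((g_SD t)⁻¹ * dg_SD t) * (g_TD t)⁻¹)) :
    ∀ t : ℝ, 0 ≤ t →
      ‖g_TD t - 1‖ ≤ ‖ξ 0‖ * Real.exp ‖ξ 0‖ * Real.exp (-k * t) := by
  haveI : NeZero n := ⟨by omega⟩
  have hlog : ∀ t, ξ t = logOneAdd (g_TD t - 1) := by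
    intro t
    rw [hξ t, matLog, logOneAdd]
    refine tsum_congr fun m => ?_
    rw [← Complex.coe_smul]
    push_cast
    rfl
  have hdet : ∀ t, IsUnit (g_ST t).det := fun t => (Matrix.isUnit_iff_isUnit_det _).mp (hSTu t)
  have hdetD : ∀ t, IsUnit (g_SD t).det := fun t => (Matrix.isUnit_iff_isUnit_det _).mp (hSDu t)
  have hg : ∀ t, HasDerivAt g_TD (-(k • (logOneAdd (g_TD t - 1) * g_TD t))) t := by
    intro t
    have hfun : g_TD = fun s => Ring.inverse (g_ST s) * g_SD s := by
      funext s
      rw [hTD s, Matrix.nonsing_inv_eq_ringInverse]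
    have hdiff : DifferentiableAt ℝ g_TD t := by
      rw [hfun]
      exact ((hST t).differentiableAt.inverse (hSTu t)).mul (hSD t).differentiableAt
    have hd := hdiff.hasDerivAt
    have hprod := (hST t).mul hd
    have heq : g_ST * g_TD = g_SD := by
      funext s
      rw [Pi.mul_apply, hTD s, Matrix.mul_nonsing_inv_cancel_left _ _ (hdet s)]
    rw [heq] at hprod
    have hu := hprod.unique (hSD t)
    have hTu : IsUnit (g_TD t).det := by
      rw [hTD t, Matrix.det_mul]
      exact (Matrix.isUnit_nonsing_inv_det _ (hdet t)).mul (hdetD t)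
    refine hd.congr_deriv ?_
    have e1 : g_ST t * g_TD t = g_SD t := congrFun heq t
    rw [hclosed t] at hu
    have e2 : g_ST t * (k • ξ t + g_TD t * ((g_SD t)⁻¹ * dg_SD t) * (g_TD t)⁻¹) * g_TD t
        = g_ST t * (k • (ξ t * g_TD t)) + dg_SD t := by
      rw [mul_assoc, add_mul, Matrix.nonsing_inv_mul_cancel_right _ _ hTu, mul_add, ← mul_assoc (g_ST t) (g_TD t),
        e1, Matrix.mul_nonsing_inv_cancel_left _ _ (hdetD t), smul_mul_assoc]
    rw [e2] at hu
    have e3 : g_ST t * deriv g_TD t = g_ST t * (-(k • (ξ t * g_TD t))) := by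
      have aux : ∀ a b c : Matrix (Fin n) (Fin n) ℂ, a + c + b = c → b = -a := by
        intro a b c h
        rw [eq_neg_iff_add_eq_zero]
        have h7 : c + (b + a) = c := by rw [← add_assoc, add_comm (c + b) a, ← add_assoc]; exact h
        exact add_eq_left.mp h7
      rw [mul_neg]
      exact aux _ _ _ hu
    rw [← hlog t]
    exact (hSTu t).mul_left_cancel e3
  intro t ht
  rw [hlog 0]
  exact error_bound k hk g_TD hnorm hg t ht
end

section
/- Let n ≥ 1, let k be a real scalar, let g_ST, g_SD : ℝ → Mₙ(ℂ) be differentiable matrix-valued functions all of whose values are invertible, and let ξ : ℝ → Mₙ(ℂ) be any matrix-valued function. Define the configuration error g_TD(t) = g_ST(t)⁻¹ · g_SD(t), the reference body velocity V(t) = g_SD(t)⁻¹ · g_SD′(t), and the control input u(t) = k · ξ(t) + g_TD(t) · V(t) · g_TD(t)⁻¹. If g_ST′(t) = g_ST(t) · u(t) for all t, then g_TD is differentiable and g_TD′(t) = −k · ξ(t) · g_TD(t) for all t. -/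
open scoped Matrix

attribute [local instance] Matrix.linftyOpNormedRing Matrix.linftyOpNormedAlgebra

/-- Under the control law `u = k ξ + g_TD V g_TD⁻¹` for the left-invariant system
`g_ST' = g_ST u`, the configuration error `g_TD = g_ST⁻¹ g_SD` is differentiable and
evolves as `g_TD' = −k ξ g_TD`. -/
theorem stmt_2 (n : ℕ) (hn : 1 ≤ n) (k : ℝ)
    (g_ST g_SD dg_SD ξ : ℝ → Matrix (Fin n) (Fin n) ℂ)
    (hSD : ∀ t : ℝ, HasDerivAt g_SD (dg_SD t) t)
    (hSTu : ∀ t : ℝ, IsUnit (g_ST t))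
    (hSDu : ∀ t : ℝ, IsUnit (g_SD t))
    (g_TD V u : ℝ → Matrix (Fin n) (Fin n) ℂ)
    (hTD : ∀ t : ℝ, g_TD t = (g_ST t)⁻¹ * g_SD t)
    (hV : ∀ t : ℝ, V t = (g_SD t)⁻¹ * dg_SD t)
    (hu : ∀ t : ℝ, u t = k • ξ t + g_TD t * V t * (g_TD t)⁻¹)
    (hST : ∀ t : ℝ, HasDerivAt g_ST (g_ST t * u t) t) :
    ∀ t : ℝ, HasDerivAt g_TD (-(k • (ξ t * g_TD t))) t := by
  intro t
  obtain ⟨a, ha⟩ := hSTu t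
  have hI := (hasFDerivAt_ringInverse (𝕜 := ℝ) a)
  rw [ha] at hI
  have h1 := hI.comp_hasDerivAt t (hST t)
  have h2 := h1.mul (hSD t)
  have hfun : g_TD = fun t => (Ring.inverse (g_ST t)) * g_SD t := by
    funext s
    rw [hTD s, Matrix.nonsing_inv_eq_ringInverse]
  have hai : ((a⁻¹ : (Matrix (Fin n) (Fin n) ℂ)ˣ) : Matrix (Fin n) (Fin n) ℂ) = (g_ST t)⁻¹ := by
    rw [← ha, Matrix.coe_units_inv]
  have hA : (g_ST t)⁻¹ * g_ST t = 1 :=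
    Matrix.nonsing_inv_mul _ ((Matrix.isUnit_iff_isUnit_det _).1 (hSTu t))
  have hB : g_SD t * (g_SD t)⁻¹ = 1 :=
    Matrix.mul_nonsing_inv _ ((Matrix.isUnit_iff_isUnit_det _).1 (hSDu t))
  have hTu : IsUnit (g_TD t) := by
    rw [hTD, ← hai]
    exact (Units.isUnit _).mul (hSDu t)
  have hC : (g_TD t)⁻¹ * g_TD t = 1 :=
    Matrix.nonsing_inv_mul _ ((Matrix.isUnit_iff_isUnit_det _).1 hTu)
  have key : g_TD t * V t = (g_ST t)⁻¹ * dg_SD t := by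
    rw [hTD, hV, mul_assoc, ← mul_assoc (g_SD t), hB, one_mul]
  have hut : u t * g_TD t = k • (ξ t * g_TD t) + (g_ST t)⁻¹ * dg_SD t := by
    rw [hu, add_mul, mul_assoc (g_TD t * V t), hC, mul_one, key, smul_mul_assoc]
  have hval : -(k • (ξ t * g_TD t)) =
      -((g_ST t)⁻¹ * (g_ST t * u t) * (g_ST t)⁻¹) * g_SD t + (g_ST t)⁻¹ * dg_SD t := by
    rw [← mul_assoc (g_ST t)⁻¹, hA, one_mul, neg_mul, mul_assoc (u t), ← hTD, hut]
    abel
  have e : -((g_ST t)⁻¹ * (g_ST t * u t) * (g_ST t)⁻¹) * g_SD t + (g_ST t)⁻¹ * dg_SD t =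
      (-((ContinuousLinearMap.mulLeftRight ℝ (Matrix (Fin n) (Fin n) ℂ))
        (a⁻¹ : (Matrix (Fin n) (Fin n) ℂ)ˣ)) (a⁻¹ : (Matrix (Fin n) (Fin n) ℂ)ˣ))
          (g_ST t * u t) * g_SD t +
      (Ring.inverse ∘ g_ST) t * dg_SD t := by
    rw [Function.comp_apply, ← Matrix.nonsing_inv_eq_ringInverse, hai]
    rfl
  rw [hval, hfun, e]
  exact h2
end

section
/- Let n ≥ 1 and let h : ℝ → Mₙ(ℂ) be differentiable with ‖h(t) − 1‖ < 1 for all t (in a submultiplicative matrix norm), and suppose h(t) commutes with h′(t) for every t. Then the function L(t) = ∑_{m=1}^∞ (−1)^{m+1} (h(t) − 1)^m / m is differentiable, h(t) is invertible for every t, and L′(t) = h′(t) · h(t)⁻¹ = h(t)⁻¹ · h′(t) for all t. -/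
open scoped Matrix

attribute [local instance] Matrix.linftyOpNormedRing Matrix.linftyOpNormedAlgebra

open scoped RightActions in
theorem logSeries_aux {A : Type*} [NormedRing A] [NormedAlgebra ℂ A] [NormOneClass A]
    [CompleteSpace A] (x d : A) (hx : ‖x‖ < 1) (hc : x * d = d * x) :
    ∃ F : A →L[ℂ] A, HasFDerivAt
      (fun y : A => ∑' m : ℕ, (((-1 : ℂ) ^ m / ((m : ℂ) + 1)) • y ^ (m + 1))) F x ∧
      F d = (∑' m : ℕ, (-x) ^ m) * d := by
  obtain ⟨r, hxr, hr1⟩ := exists_between hx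
  have hr0 : 0 ≤ r := (norm_nonneg x).trans hxr.le
  let D : ℕ → A → A →L[ℂ] A := fun m y => ((-1 : ℂ) ^ m / ((m : ℂ) + 1)) •
    (∑ i ∈ Finset.range (m + 1),
      y ^ ((m + 1).pred - i) •> ContinuousLinearMap.id ℂ A <• y ^ i)
  have hDapp : ∀ m y v, D m y v = ((-1 : ℂ) ^ m / ((m : ℂ) + 1)) •
      ∑ i ∈ Finset.range (m + 1), y ^ (m - i) * v * y ^ i := by
    intro m y v
    simp [D, mul_assoc]
  have hcn : ∀ m : ℕ, ‖((-1 : ℂ) ^ m / ((m : ℂ) + 1))‖ = 1 / ((m : ℝ) + 1) := by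
    intro m
    have : ‖((m : ℂ) + 1)‖ = (m : ℝ) + 1 := by
      rw [← Nat.cast_succ, Complex.norm_natCast, Nat.cast_succ]
    rw [norm_div, norm_pow, norm_neg, norm_one, one_pow, this]
  have hu : Summable (fun m : ℕ => r ^ m) := summable_geometric_of_lt_one hr0 hr1
  have hbound : ∀ m y, y ∈ Metric.ball (0 : A) r → ‖D m y‖ ≤ r ^ m := by
    intro m y hy
    have hy : ‖y‖ ≤ r := by simpa using (mem_ball_zero_iff.1 hy).le
    refine ContinuousLinearMap.opNorm_le_bound _ (by positivity) fun v => ?_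
    rw [hDapp, norm_smul, hcn]
    have h1 : ‖∑ i ∈ Finset.range (m + 1), y ^ (m - i) * v * y ^ i‖
        ≤ ∑ i ∈ Finset.range (m + 1), r ^ m * ‖v‖ := by
      refine norm_sum_le_of_le _ fun i hi => ?_
      have hi : i ≤ m := Nat.lt_succ_iff.1 (Finset.mem_range.1 hi)
      calc ‖y ^ (m - i) * v * y ^ i‖ ≤ ‖y‖ ^ (m - i) * ‖v‖ * ‖y‖ ^ i := by
            refine (norm_mul_le _ _).trans ?_
            gcongr
            · refine (norm_mul_le _ _).trans ?_
              gcongr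
              exact norm_pow_le _ _
            · exact norm_pow_le _ _
        _ ≤ r ^ (m - i) * ‖v‖ * r ^ i := by gcongr
        _ = r ^ m * ‖v‖ := by
            rw [mul_right_comm, ← pow_add, Nat.sub_add_cancel hi]
    rw [Finset.sum_const, Finset.card_range, nsmul_eq_mul] at h1
    have hm : (0 : ℝ) < (m : ℝ) + 1 := by positivity
    calc 1 / ((m : ℝ) + 1) * ‖∑ i ∈ Finset.range (m + 1), y ^ (m - i) * v * y ^ i‖
        ≤ 1 / ((m : ℝ) + 1) * (((m + 1 : ℕ) : ℝ) * (r ^ m * ‖v‖)) := by gcongr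
      _ = r ^ m * ‖v‖ := by push_cast; field_simp
  have hxb : x ∈ Metric.ball (0 : A) r := by simpa using hxr
  have hDs : Summable fun m => D m x := .of_norm_bounded hu fun m => hbound m x hxb
  refine ⟨∑' m, D m x, ?_, ?_⟩
  · let _ : NormedSpace ℝ A := NormedSpace.restrictScalars ℝ ℂ A
    refine hasFDerivAt_tsum_of_isPreconnected (x₀ := (0 : A)) hu Metric.isOpen_ball
      (convex_ball (0 : A) r).isPreconnected
      (fun m y _ => ?_) hbound (by simpa using (norm_nonneg x).trans_lt hxr) ?_ hxb
    · exact (hasFDerivAt_pow' (𝕜 := ℂ) (m + 1) (x := y)).const_smul ((-1 : ℂ) ^ m / ((m : ℂ) + 1))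
    · simp
  · have h1 : (∑' m, D m x) d = ∑' m, D m x d :=
      (ContinuousLinearMap.apply ℂ A d).map_tsum hDs
    rw [h1, ← (summable_geometric_of_norm_lt_one (x := -x) (by simpa using hx)).tsum_mul_right]
    refine tsum_congr fun m => ?_
    rw [hDapp]
    have h2 : ∀ i ∈ Finset.range (m + 1), x ^ (m - i) * d * x ^ i = x ^ m * d := by
      intro i hi
      have hi : i ≤ m := Nat.lt_succ_iff.1 (Finset.mem_range.1 hi)
      have : d * x ^ i = x ^ i * d := (Commute.pow_left (show Commute x d from hc) i).symm
      rw [mul_assoc, this, ← mul_assoc, ← pow_add, Nat.sub_add_cancel hi]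
    rw [Finset.sum_congr rfl h2, Finset.sum_const, Finset.card_range, ← Nat.cast_smul_eq_nsmul ℂ,
      smul_smul]
    have hm : ((m : ℂ) + 1) ≠ 0 := Nat.cast_add_one_ne_zero m
    have : (-1 : ℂ) ^ m / ((m : ℂ) + 1) * ((m + 1 : ℕ) : ℂ) = (-1) ^ m := by
      push_cast; field_simp
    rw [this, neg_pow x m, ← smul_mul_assoc]
    congr 1
    rcases Nat.even_or_odd m with h | h <;> simp [h.neg_one_pow]

/-- If `h` is differentiable with `‖h t − 1‖ < 1` and `h t` commutes with `h' t`, then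
`t ↦ log (h t)` is differentiable, `h t` is invertible, and
`(log h)' = h' h⁻¹ = h⁻¹ h'`. -/
theorem stmt_3 (n : ℕ) (hn : 1 ≤ n)
    (h dh : ℝ → Matrix (Fin n) (Fin n) ℂ)
    (hdiff : ∀ t : ℝ, HasDerivAt h (dh t) t)
    (hnorm : ∀ t : ℝ, ‖h t - 1‖ < 1)
    (hcomm : ∀ t : ℝ, h t * dh t = dh t * h t) :
    ∀ t : ℝ, IsUnit (h t) ∧
      HasDerivAt (fun s => matLog (h s)) (dh t * (h t)⁻¹) t ∧
      dh t * (h t)⁻¹ = (h t)⁻¹ * dh t := by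
  intro t
  have : Nonempty (Fin n) := ⟨⟨0, hn⟩⟩
  have hneg : ‖-(h t - 1)‖ < 1 := by rw [norm_neg]; exact hnorm t
  have hh : 1 - -(h t - 1) = h t := by abel
  have hu : IsUnit (h t) := hh ▸ isUnit_one_sub_of_norm_lt_one hneg
  have hdet : IsUnit (h t).det := (Matrix.isUnit_iff_isUnit_det _).1 hu
  have hinv : ∑' m : ℕ, (-(h t - 1)) ^ m = (h t)⁻¹ := by
    have := geom_series_mul_neg _ hneg
    rw [hh] at this
    exact (Matrix.inv_eq_left_inv this).symm
  have hci : dh t * (h t)⁻¹ = (h t)⁻¹ * dh t := by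
    calc dh t * (h t)⁻¹ = (h t)⁻¹ * (h t * dh t) * (h t)⁻¹ := by
          rw [← mul_assoc, Matrix.nonsing_inv_mul _ hdet, one_mul]
      _ = (h t)⁻¹ * dh t := by
          rw [hcomm, mul_assoc, mul_assoc, Matrix.mul_nonsing_inv _ hdet, mul_one]
  refine ⟨hu, ?_, hci⟩
  obtain ⟨F, hF, hFd⟩ := logSeries_aux (h t - 1) (dh t) (hnorm t)
    (by rw [sub_mul, mul_sub, hcomm, one_mul, mul_one])
  have hk : HasDerivAt (fun s => h s - 1) (dh t) t := (hdiff t).sub_const 1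
  have := (hF.restrictScalars ℝ).comp_hasDerivAt t hk
  have hval : F (dh t) = dh t * (h t)⁻¹ := by
    refine hFd.trans ?_
    rw [hci, ← hinv]
    rfl
  rw [← hval]
  exact this
end
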